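/- Every subfamily of AN of cardinality strictly less than 𝔟 (the unbounding number) is bounded in (AN, ≤_K): for every family {I_α : α < κ} ⊆ AN with κ < 𝔟 there exists J ∈ AN such that I_α ≤_K J for all α < κ. -/

import Mathlib

open Filter Topology Set MeasureTheory
open scoped ENNReal NNReal

noncomputable section

/-- The space `N_F = ℕ ∪ {p_F}`, modelled as `Option ℕ` with `none` playing the role of `p_F`:
every natural number (i.e. `some n`) is isolated, and a set containing `none` is open iff its
trace on `ℕ` belongs to `F`. -/
def NFTop (F : Filter ℕ) : TopologicalSpace (Option ℕ) where
  IsOpen U := none ∈ U → {n : ℕ | some n ∈ U} ∈ F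
  isOpen_univ := fun _ => Filter.univ_mem
  isOpen_inter := fun U V hU hV h => Filter.inter_mem (hU h.1) (hV h.2)
  isOpen_sUnion := fun S hS h => by
    obtain ⟨U, hUS, hU⟩ := h
    exact Filter.mem_of_superset (hS U hUS hU) fun n hn => ⟨U, hUS, hn⟩

/-- A finitely supported signed measure on `N_F` is modelled as a finitely supported
function `Option ℕ →₀ ℝ`; its value on a set `A` is the sum of its weights on `A`. -/
def fsMeas (μ : Option ℕ →₀ ℝ) (A : Set (Option ℕ)) : ℝ :=
  ∑ x ∈ μ.support, A.indicator (fun y => μ y) x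

/-- The norm `‖μ‖ = Σ |α_i|` of a finitely supported signed measure. -/
def fsNorm (μ : Option ℕ →₀ ℝ) : ℝ :=
  ∑ x ∈ μ.support, |μ x|

/-- `‖μ ↾ B‖`, the variation of `μ` on a set `B`. -/
def fsRestrNorm (μ : Option ℕ →₀ ℝ) (B : Set (Option ℕ)) : ℝ :=
  ∑ x ∈ μ.support, B.indicator (fun y => |μ y|) x

/-- The integral `∫ f dμ` of a function against a finitely supported signed measure. -/
def fsInteg (μ : Option ℕ →₀ ℝ) (f : Option ℕ → ℝ) : ℝ :=
  ∑ x ∈ μ.support, μ x * f x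

/-- An anti-Nikodym sequence on `N_F`: `‖μ_n‖ → ∞` and `μ_n(A) → 0` for every clopen `A`. -/
def IsANSeq (F : Filter ℕ) (μ : ℕ → (Option ℕ →₀ ℝ)) : Prop :=
  Tendsto (fun n => fsNorm (μ n)) atTop atTop ∧
    ∀ A : Set (Option ℕ), @IsClopen _ (NFTop F) A →
      Tendsto (fun n => fsMeas (μ n) A) atTop (nhds 0)

/-- A free filter `F` has the Nikodym property if there is no anti-Nikodym sequence on `N_F`. -/
def HasNikodymProp (F : Filter ℕ) : Prop :=
  ¬ ∃ μ : ℕ → (Option ℕ →₀ ℝ), IsANSeq F μ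

/-- A finitely supported (nonnegative) measure on `ℕ`, evaluated on a set `A ⊆ ℕ`. -/
def natMeas (μ : ℕ →₀ ℝ) (A : Set ℕ) : ℝ :=
  ∑ x ∈ μ.support, A.indicator (fun y => μ y) x

/-- The norm of a finitely supported measure on `ℕ`. -/
def natNorm (μ : ℕ →₀ ℝ) : ℝ :=
  ∑ x ∈ μ.support, |μ x|

/-- `at⁺(μ)`: the largest atom of a finitely supported measure on `ℕ`. -/
def atPlus (μ : ℕ →₀ ℝ) : ℝ := sSup ((fun x => μ x) '' ↑μ.support)

/-- `at⁻(μ)`: the smallest atom of a finitely supported measure on `ℕ`. -/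
def atMinus (μ : ℕ →₀ ℝ) : ℝ := sInf ((fun x => μ x) '' ↑μ.support)

/-- A submeasure on `ω`. -/
structure Submeasure where
  toFun : Set ℕ → ℝ≥0∞
  empty' : toFun ∅ = 0
  finite_singleton' : ∀ n : ℕ, toFun {n} ≠ ⊤
  mono' : ∀ ⦃A B : Set ℕ⦄, A ⊆ B → toFun A ≤ toFun B
  subadd' : ∀ A B : Set ℕ, toFun (A ∪ B) ≤ toFun A + toFun B

/-- Lower semicontinuity of a submeasure: `φ(A) = lim_n φ(A ∩ [0,n])`. -/
def Submeasure.LSC (φ : Submeasure) : Prop :=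
  ∀ A : Set ℕ, Tendsto (fun n : ℕ => φ.toFun (A ∩ Set.Iic n)) atTop (nhds (φ.toFun A))

/-- The exhaustive ideal `Exh(φ) = {A : lim_n φ(A ∖ [0,n]) = 0}` of a submeasure. -/
def Exh (φ : Submeasure) : Set (Set ℕ) :=
  {A : Set ℕ | Tendsto (fun n : ℕ => φ.toFun (A \ Set.Iic n)) atTop (nhds 0)}

/-- A density submeasure: `φ = sup_n μ_n` for a sequence of finitely supported nonnegative
measures on `ℕ` with pairwise disjoint supports. -/
def Submeasure.IsDensity (φ : Submeasure) : Prop :=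
  ∃ μ : ℕ → (ℕ →₀ ℝ), (∀ n x, 0 ≤ μ n x) ∧
    (∀ m n, m ≠ n → Disjoint (μ m).support (μ n).support) ∧
    ∀ A : Set ℕ, φ.toFun A = ⨆ n : ℕ, ENNReal.ofReal (natMeas (μ n) A)

/-- A non-pathological submeasure: `φ(A)` is the supremum of `μ(A)` over all nonnegative
(σ-additive) measures `μ` on `ℕ` dominated by `φ`. -/
def Submeasure.Nonpathological (φ : Submeasure) : Prop :=
  ∀ A : Set ℕ,
    φ.toFun A =
      ⨆ (w : ℕ → ℝ≥0∞) (_ : ∀ B : Set ℕ, ∑' n : B, w n ≤ φ.toFun B), ∑' n : A, w n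

/-- An ideal on `ω`: contains all finite sets, closed under subsets and finite unions,
and does not contain `ℕ` itself. -/
def IsIdeal (I : Set (Set ℕ)) : Prop :=
  (∀ A : Set ℕ, A.Finite → A ∈ I) ∧
    (∀ A B : Set ℕ, A ⊆ B → B ∈ I → A ∈ I) ∧
    (∀ A B : Set ℕ, A ∈ I → B ∈ I → A ∪ B ∈ I) ∧
    Set.univ ∉ I

/-- The Katětov order on families of subsets of `ℕ`. -/
def KatLE (I J : Set (Set ℕ)) : Prop :=
  ∃ f : ℕ → ℕ, ∀ A ∈ I, f ⁻¹' A ∈ J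

/-- The dual filter `I*` of an ideal `I` (as a `Filter`; when `I` is an ideal, this filter's
sets are exactly the complements of members of `I`). -/
def dualFilter (I : Set (Set ℕ)) : Filter ℕ :=
  Filter.generate {A : Set ℕ | Aᶜ ∈ I}

/-- The class `AN` of all ideals on `ω` whose dual filters do not have the Nikodym property. -/
def ANclass : Set (Set (Set ℕ)) :=
  {I | IsIdeal I ∧ ¬ HasNikodymProp (dualFilter I)}

/-- A density ideal: `Exh(sup_n μ_n)` for a disjointly supported sequence of finitely
supported nonnegative measures on `ℕ`. -/
def IsDensityIdeal (I : Set (Set ℕ)) : Prop :=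
  ∃ μ : ℕ → (ℕ →₀ ℝ), (∀ n x, 0 ≤ μ n x) ∧
    (∀ m n, m ≠ n → Disjoint (μ m).support (μ n).support) ∧
    I = {A : Set ℕ |
      Tendsto (fun m : ℕ => ⨆ n : ℕ, ENNReal.ofReal (natMeas (μ n) (A \ Set.Iic m)))
        atTop (nhds 0)}

/-- The asymptotic density submeasure `φ_d(A) = sup_n |A ∩ [2^n, 2^{n+1})|/2^n`. -/
def phid (A : Set ℕ) : ℝ≥0∞ :=
  ⨆ n : ℕ, ((A ∩ Set.Ico (2 ^ n) (2 ^ (n + 1))).ncard : ℝ≥0∞) / 2 ^ n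

/-- The asymptotic density zero ideal `Z = Exh(φ_d)`. -/
def Zideal : Set (Set ℕ) :=
  {A : Set ℕ | Tendsto (fun m : ℕ => phid (A \ Set.Iic m)) atTop (nhds 0)}

/-- `Exh(sup_{n ≥ 1} ν_n)` for a sequence of finitely supported measures indexed by `n ≥ 1`. -/
def ExhSupPos (ν : ℕ → (ℕ →₀ ℝ)) : Set (Set ℕ) :=
  {A : Set ℕ |
    Tendsto (fun m : ℕ => ⨆ n : ℕ, ENNReal.ofReal (natMeas (ν (n + 1)) (A \ Set.Iic m)))
      atTop (nhds 0)}

/-- `PhiStart f n` is the left endpoint of the interval `I_n` in the interval partition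
associated with `f` (so `I_n = [PhiStart f n, PhiStart f (n+1))` has `n·f(n)` elements). -/
def PhiStart (f : ℕ → ℕ) (n : ℕ) : ℕ :=
  ∑ k ∈ Finset.range n, k * f k

/-- The density ideal `Φ(f) = Exh(sup_{n≥1} μ_n^f)`, where `μ_n^f` gives mass `1/f(n)` to each
point of the interval `I_n` (of size `n·f(n)`), so that `‖μ_n^f‖ = n`. -/
def PhiIdeal (f : ℕ → ℕ) : Set (Set ℕ) :=
  {A : Set ℕ |
    Tendsto (fun m : ℕ => ⨆ n : ℕ,
        ENNReal.ofReal
          (((A \ Set.Iic m) ∩ Set.Ico (PhiStart f (n + 1)) (PhiStart f (n + 2))).ncard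
            / f (n + 1)))
      atTop (nhds 0)}

/-- The dominating number `𝔡`. -/
def domNumber : Cardinal :=
  sInf {c : Cardinal | ∃ D : Set (ℕ → ℕ), Cardinal.mk D = c ∧
    ∀ g : ℕ → ℕ, ∃ f ∈ D, ∀ᶠ n in atTop, g n ≤ f n}

/-- The unbounding number `𝔟`. -/
def unbNumber : Cardinal :=
  sInf {c : Cardinal | ∃ U : Set (ℕ → ℕ), Cardinal.mk U = c ∧
    ∀ g : ℕ → ℕ, ∃ f ∈ U, {n : ℕ | g n < f n}.Infinite}

/-- A P-ideal: every countable family in `J` has a pseudo-union in `J`. -/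
def IsPIdeal (J : Set (Set ℕ)) : Prop :=
  ∀ A : ℕ → Set ℕ, (∀ n, A n ∈ J) → ∃ B ∈ J, ∀ n, (A n \ B).Finite

/-- The characteristic-function embedding of `P(ℕ)` into the Cantor space `2^ℕ`. -/
def chi (A : Set ℕ) : ℕ → Bool :=
  fun n => @decide (n ∈ A) (Classical.propDecidable _)

end

lemma natMeas_eq_sum {v : ℕ →₀ ℝ} {T : Finset ℕ} (h : v.support ⊆ T) (A : Set ℕ) :
    natMeas v A = ∑ x ∈ T, A.indicator v x := by
  refine Finset.sum_subset h fun x _ hx => ?_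
  rw [Finsupp.notMem_support_iff] at hx
  by_cases hA : x ∈ A <;> simp [hA, hx]

lemma natNorm_eq_sum {v : ℕ →₀ ℝ} {T : Finset ℕ} (h : v.support ⊆ T) :
    natNorm v = ∑ x ∈ T, |v x| := by
  refine Finset.sum_subset h fun x _ hx => ?_
  simpa using hx

lemma natMeas_singleton (v : ℕ →₀ ℝ) (k : ℕ) : natMeas v {k} = v k := by
  rw [natMeas_eq_sum (Finset.subset_insert k v.support), Finset.sum_eq_single k]
  · simp
  · intro b _ hb
    simp [hb]
  · simp

lemma natMeas_filter (v : ℕ →₀ ℝ) (A B : Set ℕ) [DecidablePred (· ∈ A)] :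
    natMeas (v.filter (· ∈ A)) B = natMeas v (A ∩ B) := by
  rw [natMeas_eq_sum (T := v.support) (by simp)]
  refine Finset.sum_congr rfl fun x _ => ?_
  by_cases hA : x ∈ A <;> by_cases hB : x ∈ B <;> simp [hA, hB]

lemma abs_natMeas_le (v : ℕ →₀ ℝ) (A : Set ℕ) : |natMeas v A| ≤ natNorm v := by
  refine (Finset.abs_sum_le_sum_abs _ _).trans (Finset.sum_le_sum fun x _ => ?_)
  by_cases hA : x ∈ A <;> simp [hA]

lemma natMeas_mono {v : ℕ →₀ ℝ} (hv : ∀ x, 0 ≤ v x) {A B : Set ℕ} (h : A ⊆ B) :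
    natMeas v A ≤ natMeas v B :=
  Finset.sum_le_sum fun x _ => Set.indicator_le_indicator_of_subset h hv x

lemma natMeas_nonneg {v : ℕ →₀ ℝ} (hv : ∀ x, 0 ≤ v x) (A : Set ℕ) : 0 ≤ natMeas v A :=
  Finset.sum_nonneg fun x _ => Set.indicator_nonneg (fun y _ => hv y) x

lemma natMeas_union_le {v : ℕ →₀ ℝ} (hv : ∀ x, 0 ≤ v x) (A B : Set ℕ) :
    natMeas v (A ∪ B) ≤ natMeas v A + natMeas v B := by
  unfold natMeas
  rw [← Finset.sum_add_distrib]
  refine Finset.sum_le_sum fun x _ => ?_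
  have := hv x
  by_cases hA : x ∈ A <;> by_cases hB : x ∈ B <;> simp [hA, hB, this]

lemma natMeas_add_compl (v : ℕ →₀ ℝ) (A : Set ℕ) :
    natMeas v A + natMeas v Aᶜ = natMeas v Set.univ := by
  unfold natMeas
  rw [← Finset.sum_add_distrib]
  refine Finset.sum_congr rfl fun x _ => ?_
  by_cases hA : x ∈ A <;> simp [hA]

/-- Some set captures a fixed proportion of the variation of a finite signed sum. -/
lemma exists_set_sum_indicator_ge (T : Finset ℕ) (w : ℕ → ℝ) :
    ∃ C : Set ℕ, (∑ x ∈ T, |w x|) / 2 ≤ |∑ x ∈ T, C.indicator w x| := by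
  set P : Set ℕ := {x | 0 ≤ w x}
  have key : ∑ x ∈ T, |w x| = ∑ x ∈ T, P.indicator w x - ∑ x ∈ T, Pᶜ.indicator w x := by
    rw [← Finset.sum_sub_distrib]
    refine Finset.sum_congr rfl fun x _ => ?_
    by_cases hx : 0 ≤ w x
    · have hP : x ∈ P := hx
      simp [hP, abs_of_nonneg hx]
    · have hP : x ∉ P := hx
      simp [hP, abs_of_neg (not_le.mp hx)]
  have h1 := le_abs_self (∑ x ∈ T, P.indicator w x)
  have h2 := neg_abs_le (∑ x ∈ T, Pᶜ.indicator w x)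
  by_contra! h
  have h3 := h P
  have h4 := h Pᶜ
  linarith

/-- A sequence of finitely supported signed measures on `ℕ` converging to `0` on every set
converges to `0` in norm. -/
lemma tendsto_natNorm_zero (v : ℕ → ℕ →₀ ℝ)
    (h : ∀ B : Set ℕ, Tendsto (fun n => natMeas (v n) B) atTop (𝓝 0)) :
    Tendsto (fun n => natNorm (v n)) atTop (𝓝 0) := by
  by_contra hcon
  obtain ⟨ε, hε, hfreq⟩ : ∃ ε > 0, ∃ᶠ n in atTop, ε ≤ natNorm (v n) := by
    by_contra! hno
    refine hcon (tendsto_order.2 ⟨fun a ha => Eventually.of_forall fun n => ?_, fun a ha => ?_⟩)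
    · exact ha.trans_le (Finset.sum_nonneg fun x _ => abs_nonneg _)
    · simpa using hno a ha
  have step : ∀ m : ℕ, ∃ (n m' : ℕ) (C : Set ℕ), m ≤ n ∧ m < m' ∧
      (v n).support ⊆ Finset.range m' ∧ ∑ x ∈ Finset.range m, |v n x| < ε / 8 ∧
      3 * ε / 8 ≤ |∑ x ∈ Finset.Ico m m', C.indicator (v n) x| := by
    intro m
    have hsmall : Tendsto (fun n => ∑ x ∈ Finset.range m, |v n x|) atTop (𝓝 0) := by
      have : Tendsto (fun n => ∑ x ∈ Finset.range m, |v n x|) atTop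
          (𝓝 (∑ x ∈ Finset.range m, |(0 : ℝ)|)) := by
        refine tendsto_finsetSum _ fun x _ => Tendsto.abs ?_
        simpa only [natMeas_singleton] using h {x}
      simpa using this
    obtain ⟨n, hn, hlt, hmn⟩ := (hfreq.and_eventually
      ((hsmall.eventually_lt_const (show (0 : ℝ) < ε / 8 by positivity)).and
        (eventually_ge_atTop m))).exists
    obtain ⟨b, hb⟩ := (v n).support.exists_nat_subset_range
    have hsub : (v n).support ⊆ Finset.range (max b (m + 1)) :=
      hb.trans (Finset.range_subset_range.2 (le_max_left _ _))
    obtain ⟨C, hC⟩ := exists_set_sum_indicator_ge (Finset.Ico m (max b (m + 1))) (v n)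
    refine ⟨n, max b (m + 1), C, hmn, by omega, hsub, hlt, ?_⟩
    rw [natNorm_eq_sum hsub, ← Finset.sum_range_add_sum_Ico _ (show m ≤ max b (m + 1) by omega)]
      at hn
    linarith
  choose n m' C hmn hmm' hsub hsmall hbig using step
  let M : ℕ → ℕ := fun k => m'^[k] 0
  have hM : ∀ k, M (k + 1) = m' (M k) := fun k => Function.iterate_succ_apply' m' k 0
  have hMmono : StrictMono M := strictMono_nat_of_lt_succ fun k => by rw [hM]; exact hmm' _
  let B : Set ℕ := {x | ∃ k, M k ≤ x ∧ x < M (k + 1) ∧ x ∈ C (M k)}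
  have hB : ∀ k x, M k ≤ x → x < M (k + 1) → (x ∈ B ↔ x ∈ C (M k)) := by
    intro k x h1 h2
    refine ⟨?_, fun hx => ⟨k, h1, h2, hx⟩⟩
    rintro ⟨l, h3, h4, h5⟩
    have h6 : l < k + 1 := hMmono.lt_iff_lt.1 (h3.trans_lt h2)
    have h7 : k < l + 1 := hMmono.lt_iff_lt.1 (h1.trans_lt h4)
    obtain rfl : l = k := by omega
    exact h5
  have hlow : ∀ k, ε / 4 ≤ |natMeas (v (n (M k))) B| := by
    intro k
    rw [natMeas_eq_sum (hsub (M k)), ← Finset.sum_range_add_sum_Ico _ (hmm' (M k)).le]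
    have e : ∑ x ∈ Finset.Ico (M k) (m' (M k)), B.indicator (v (n (M k))) x
        = ∑ x ∈ Finset.Ico (M k) (m' (M k)), (C (M k)).indicator (v (n (M k))) x := by
      refine Finset.sum_congr rfl fun x hx => ?_
      rw [Finset.mem_Ico] at hx
      have := hB k x hx.1 (by rw [hM]; exact hx.2)
      by_cases hxC : x ∈ C (M k)
      · simp [hxC, this.2 hxC]
      · simp [hxC, mt this.1 hxC]
    have e2 : |∑ x ∈ Finset.range (M k), B.indicator (v (n (M k))) x| ≤ ε / 8 := by
      refine ((Finset.abs_sum_le_sum_abs _ _).trans (Finset.sum_le_sum fun x _ => ?_)).trans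
        (hsmall (M k)).le
      by_cases hA : x ∈ B <;> simp [hA]
    rw [e]
    have h3 := hbig (M k)
    have h4 := abs_add_le (∑ x ∈ Finset.range (M k), B.indicator (v (n (M k))) x +
      ∑ x ∈ Finset.Ico (M k) (m' (M k)), (C (M k)).indicator (v (n (M k))) x)
      (-∑ x ∈ Finset.range (M k), B.indicator (v (n (M k))) x)
    rw [add_neg_cancel_comm, abs_neg] at h4
    linarith
  have hlim : Tendsto (fun k => n (M k)) atTop atTop :=
    tendsto_atTop_mono (fun k => (hMmono.le_apply).trans (hmn (M k))) tendsto_id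
  have h0 := ((h B).comp hlim).abs
  have := ge_of_tendsto' h0 hlow
  simp only [abs_zero] at this
  linarith

lemma mem_dualFilter {I : Set (Set ℕ)} (hI : IsIdeal I) {A : Set ℕ} :
    A ∈ dualFilter I ↔ Aᶜ ∈ I := by
  refine ⟨fun h => ?_, fun h => Filter.mem_generate_of_mem h⟩
  induction h with
  | basic h => exact h
  | univ => simpa using hI.1 ∅ Set.finite_empty
  | superset _ hst ih => exact hI.2.1 _ _ (Set.compl_subset_compl.2 hst) ih
  | inter _ _ ih1 ih2 =>
    rw [Set.compl_inter]
    exact hI.2.2.1 _ _ ih1 ih2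

open Classical in
lemma isClopen_NFTop_iff {I : Set (Set ℕ)} (hI : IsIdeal I) (A : Set (Option ℕ)) :
    @IsClopen _ (NFTop (dualFilter I)) A ↔
      if none ∈ A then (some ⁻¹' A)ᶜ ∈ I else some ⁻¹' A ∈ I := by
  have ho : ∀ U : Set (Option ℕ), @IsOpen _ (NFTop (dualFilter I)) U ↔
      (none ∈ U → (some ⁻¹' U)ᶜ ∈ I) := fun U => by
    rw [← mem_dualFilter hI]
    rfl
  rw [@IsClopen.eq_def _ (NFTop (dualFilter I)), ← @isOpen_compl_iff _ _ (NFTop (dualFilter I)), ho, ho]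
  by_cases h : none ∈ A <;> simp [h]

lemma sum_support_option (μ : Option ℕ →₀ ℝ) (g : Option ℕ → ℝ) (hg : ∀ x, μ x = 0 → g x = 0) :
    ∑ x ∈ μ.support, g x = g none + ∑ x ∈ μ.some.support, g (some x) := by
  rw [← Finset.sum_insertNone]
  refine Finset.sum_subset (fun x hx => ?_) fun x _ hx => hg x (by simpa using hx)
  cases x <;> simp_all

lemma fsMeas_eq (μ : Option ℕ →₀ ℝ) (A : Set (Option ℕ)) :
    fsMeas μ A = A.indicator μ none + natMeas μ.some (some ⁻¹' A) := by
  refine sum_support_option μ (A.indicator μ) fun x hx => ?_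
  by_cases hA : x ∈ A <;> simp [hA, hx]

lemma fsNorm_eq (μ : Option ℕ →₀ ℝ) : fsNorm μ = |μ none| + natNorm μ.some :=
  sum_support_option μ (fun x => |μ x|) fun x hx => by simp [hx]

/-- An ideal in `AN` is annihilated by a sequence of nonnegative finitely supported measures
on `ℕ` with unbounded masses. -/
lemma exists_measures_of_mem_ANclass {I : Set (Set ℕ)} (h : I ∈ ANclass) :
    ∃ ν : ℕ → ℕ →₀ ℝ, (∀ n x, 0 ≤ ν n x) ∧
      Tendsto (fun n => natMeas (ν n) Set.univ) atTop atTop ∧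
      ∀ A ∈ I, Tendsto (fun n => natMeas (ν n) A) atTop (𝓝 0) := by
  classical
  obtain ⟨hI, hN⟩ := h
  obtain ⟨μ, hnorm, hμ⟩ := not_not.1 hN
  have hmeas : ∀ A ∈ I, Tendsto (fun n => natMeas (μ n).some A) atTop (𝓝 0) := by
    intro A hA
    have := hμ (some '' A) ((isClopen_NFTop_iff hI _).2
      (by simpa [Set.preimage_image_eq _ (Option.some_injective ℕ)] using hA))
    simpa [fsMeas_eq, Set.preimage_image_eq _ (Option.some_injective ℕ)] using this
  refine ⟨fun n => (μ n).some.mapRange abs abs_zero, fun n x => by simp, ?_, fun A hA => ?_⟩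
  · have huniv : Tendsto (fun n => |fsMeas (μ n) Set.univ|) atTop (𝓝 0) := by
      simpa using (hμ Set.univ (@isClopen_univ _ (NFTop (dualFilter I)))).abs
    have h1 : Tendsto (fun n => (fsNorm (μ n) + -|fsMeas (μ n) Set.univ|) / 2) atTop atTop :=
      (hnorm.atTop_add huniv.neg).atTop_div_const two_pos
    refine tendsto_atTop_mono (fun n => ?_) h1
    have e : natMeas ((μ n).some.mapRange abs abs_zero) Set.univ = natNorm (μ n).some := by
      rw [natMeas_eq_sum Finsupp.support_mapRange, natNorm]
      simp
    rw [e, fsNorm_eq, fsMeas_eq]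
    have h2 := abs_natMeas_le (μ n).some Set.univ
    have h3 := abs_add_le (μ n none + natMeas (μ n).some Set.univ)
      (-natMeas (μ n).some Set.univ)
    rw [add_neg_cancel_right, abs_neg] at h3
    simp only [Set.indicator_univ, Set.preimage_univ]
    linarith
  · have h1 := tendsto_natNorm_zero (fun n => (μ n).some.filter (· ∈ A)) fun B => by
      simpa only [natMeas_filter] using hmeas _ (hI.2.1 _ _ Set.inter_subset_left hA)
    refine h1.congr fun n => ?_
    rw [natMeas_eq_sum Finsupp.support_mapRange,
      natNorm_eq_sum (T := (μ n).some.support) (by simp)]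
    refine Finset.sum_congr rfl fun x _ => ?_
    by_cases hx : x ∈ A <;> simp [hx]

/-- The sets annihilated by a sequence of nonnegative measures with unbounded masses and
pointwise vanishing atoms form an ideal in `AN`. -/
lemma annihilated_mem_ANclass {ν : ℕ → ℕ →₀ ℝ} (hν : ∀ n x, 0 ≤ ν n x)
    (hmass : Tendsto (fun n => natMeas (ν n) Set.univ) atTop atTop)
    (hatom : ∀ x, Tendsto (fun n => ν n x) atTop (𝓝 0)) :
    {A : Set ℕ | Tendsto (fun n => natMeas (ν n) A) atTop (𝓝 0)} ∈ ANclass := by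
  have hsub : ∀ A B : Set ℕ, A ⊆ B → Tendsto (fun n => natMeas (ν n) B) atTop (𝓝 0) →
      Tendsto (fun n => natMeas (ν n) A) atTop (𝓝 0) := fun A B hAB hB =>
    squeeze_zero (fun n => natMeas_nonneg (hν n) A) (fun n => natMeas_mono (hν n) hAB) hB
  have hunion : ∀ A B : Set ℕ, Tendsto (fun n => natMeas (ν n) A) atTop (𝓝 0) →
      Tendsto (fun n => natMeas (ν n) B) atTop (𝓝 0) →
      Tendsto (fun n => natMeas (ν n) (A ∪ B)) atTop (𝓝 0) := fun A B hA hB =>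
    squeeze_zero (fun n => natMeas_nonneg (hν n) _) (fun n => natMeas_union_le (hν n) A B)
      (by simpa using hA.add hB)
  have hI : IsIdeal {A : Set ℕ | Tendsto (fun n => natMeas (ν n) A) atTop (𝓝 0)} := by
    refine ⟨fun A hA => ?_, hsub, hunion, fun h => not_tendsto_nhds_of_tendsto_atTop hmass 0 h⟩
    induction A, hA using Set.Finite.induction_on with
    | empty => simp [natMeas]
    | @insert a s _ _ ih =>
      rw [Set.insert_eq]
      exact hunion _ _ (by simpa only [natMeas_singleton] using hatom a) ih
  refine ⟨hI, not_not.2 ⟨fun n => (ν n).optionElim (-natMeas (ν n) Set.univ), ?_, fun A hA => ?_⟩⟩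
  · refine tendsto_atTop_mono (fun n => ?_) hmass
    rw [fsNorm_eq, Finsupp.some_optionElim, Finsupp.optionElim_apply_none, abs_neg]
    have h1 := abs_natMeas_le (ν n) Set.univ
    have h2 := le_abs_self (natMeas (ν n) Set.univ)
    have h3 := abs_nonneg (natMeas (ν n) Set.univ)
    linarith
  · rw [isClopen_NFTop_iff hI] at hA
    simp only [fsMeas_eq, Finsupp.some_optionElim]
    split_ifs at hA with h
    · have : Tendsto (fun n => natMeas (ν n) (some ⁻¹' A)ᶜ) atTop (𝓝 0) := hA
      refine (show Tendsto (fun n => -natMeas (ν n) (some ⁻¹' A)ᶜ) atTop (𝓝 0) by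
        simpa using this.neg).congr fun n => ?_
      rw [Set.indicator_of_mem h, Finsupp.optionElim_apply_none, ← natMeas_add_compl (ν n) (some ⁻¹' A)]
      ring
    · simpa [h] using hA

/-- The uniform measure giving mass `1 / b` to each of the `n * b` points `Nat.pair n j`,
`j < n * b`. -/
noncomputable def blockMeas (n b : ℕ) : ℕ →₀ ℝ :=
  Finsupp.indicator ((Finset.range (n * b)).image (Nat.pair n)) fun _ _ => 1 / (b : ℝ)

lemma blockMeas_nonneg (n b x : ℕ) : 0 ≤ blockMeas n b x := by
  classical
  rw [blockMeas, Finsupp.indicator_apply]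
  split_ifs <;> positivity

open Classical in
lemma natMeas_blockMeas (n b : ℕ) (A : Set ℕ) :
    natMeas (blockMeas n b) A =
      ((Finset.range (n * b)).filter fun j => Nat.pair n j ∈ A).card / (b : ℝ) := by
  rw [blockMeas, natMeas_eq_sum (Finsupp.support_indicator_subset _ _), Finset.sum_image (by simp),
    Finset.card_filter, Nat.cast_sum, Finset.sum_div]
  refine Finset.sum_congr rfl fun j hj => ?_
  rw [Finset.mem_range] at hj
  by_cases hA : Nat.pair n j ∈ A <;> simp [hA, Finsupp.indicator_apply, hj]

/-- A measure of mass at least `n + 1` with at most `b` atoms dominates an image of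
`blockMeas n b`. -/
lemma exists_blockMeas_preimage_le {v : ℕ →₀ ℝ} (hv : ∀ x, 0 ≤ v x) {n b : ℕ} (hb : 0 < b)
    (hmass : (n + 1 : ℝ) ≤ natMeas v Set.univ) (hcard : v.support.card ≤ b) :
    ∃ φ : ℕ → ℕ, ∀ f : ℕ → ℕ, (∀ j, f (Nat.pair n j) = φ j) → ∀ A : Set ℕ,
      natMeas (blockMeas n b) (f ⁻¹' A) ≤ natMeas v A := by
  classical
  have hb' : (0 : ℝ) < b := by exact_mod_cast hb
  set c : ℕ → ℕ := fun x => ⌊v x * b⌋₊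
  set T : Finset (Σ _ : ℕ, ℕ) := v.support.sigma fun x => Finset.range (c x)
  have hT : n * b ≤ T.card := by
    rw [Finset.card_sigma]
    simp only [Finset.card_range]
    have h1 : ∑ x ∈ v.support, (v x * b - 1) ≤ ∑ x ∈ v.support, (c x : ℝ) :=
      Finset.sum_le_sum fun x _ => (Nat.sub_one_lt_floor _).le
    rw [Finset.sum_sub_distrib, ← Finset.sum_mul] at h1
    simp only [Finset.sum_const, nsmul_eq_mul, mul_one] at h1
    have h2 : (n + 1 : ℝ) * b ≤ (∑ x ∈ v.support, v x) * b := by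
      refine mul_le_mul_of_nonneg_right ?_ hb'.le
      simpa [natMeas] using hmass
    have h3 : (v.support.card : ℝ) ≤ b := by exact_mod_cast hcard
    have h4 : (n * b : ℝ) ≤ ∑ x ∈ v.support, (c x : ℝ) := by linarith
    exact_mod_cast h4
  obtain ⟨g, hgT, hg⟩ := (Finset.range (n * b)).finite_toSet.exists_injOn_of_encard_le
    (t := (T : Set (Σ _ : ℕ, ℕ))) (by
      rw [Set.encard_coe_eq_coe_finsetCard, Set.encard_coe_eq_coe_finsetCard, Finset.card_range]
      exact_mod_cast hT)
  refine ⟨fun j => (g j).1, fun f hf A => ?_⟩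
  rw [natMeas_blockMeas, div_le_iff₀ hb']
  have h1 : ((Finset.range (n * b)).filter fun j => Nat.pair n j ∈ f ⁻¹' A).card ≤
      ((v.support.filter (· ∈ A)).sigma fun x => Finset.range (c x)).card := by
    refine Finset.card_le_card_of_injOn g (fun j hj => ?_) (hg.mono fun j hj => ?_)
    · simp only [Finset.coe_filter, Set.mem_ofPred_eq, Set.mem_preimage, hf] at hj
      have h2 : g j ∈ T := hgT (by simpa using hj.1)
      simp only [T, Finset.mem_sigma] at h2
      simp only [Finset.coe_sigma, Set.mem_sigma_iff, Finset.mem_coe, Finset.mem_filter]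
      exact ⟨⟨h2.1, hj.2⟩, h2.2⟩
    · simp only [Finset.coe_filter, Set.mem_ofPred_eq] at hj
      simpa using hj.1
  rw [Finset.card_sigma] at h1
  simp only [Finset.card_range] at h1
  calc (((Finset.range (n * b)).filter fun j => Nat.pair n j ∈ f ⁻¹' A).card : ℝ)
      ≤ ∑ x ∈ v.support.filter (· ∈ A), (c x : ℝ) := by exact_mod_cast h1
    _ ≤ ∑ x ∈ v.support.filter (· ∈ A), v x * b :=
      Finset.sum_le_sum fun x _ => Nat.floor_le (mul_nonneg (hv x) hb'.le)
    _ = natMeas v A * b := by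
      rw [natMeas, Finset.sum_mul, Finset.sum_filter]
      refine Finset.sum_congr rfl fun x _ => ?_
      by_cases hx : x ∈ A <;> simp [hx]

/-- Families of functions of size less than `𝔟` are eventually dominated by one function. -/
lemma exists_eventually_le_of_card_lt {ι : Type} (hι : Cardinal.mk ι < unbNumber)
    (s : ι → ℕ → ℕ) : ∃ g : ℕ → ℕ, ∀ i, ∀ᶠ n in atTop, s i n ≤ g n := by
  by_contra! hcon
  refine absurd (Cardinal.mk_range_le (f := s)) (not_le.2 (hι.trans_le (csInf_le' ?_)))
  refine ⟨Set.range s, rfl, fun g => ?_⟩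
  obtain ⟨i, hi⟩ := hcon g
  exact ⟨s i, ⟨i, rfl⟩, Nat.frequently_atTop_iff_infinite.1 (by simpa using hi)⟩

/-- Corollary `bound`. Every subfamily of `AN` of cardinality less than the
unbounding number `𝔟` is bounded in `(AN, ≤_K)`. -/
theorem AN_small_families_bounded (𝔉 : Set (Set (Set ℕ)))
    (hsub : 𝔉 ⊆ ANclass) (hcard : Cardinal.mk 𝔉 < unbNumber) :
    ∃ J ∈ ANclass, ∀ I ∈ 𝔉, KatLE I J := by
  have hex : ∀ I : 𝔉, ∃ ν : ℕ → ℕ →₀ ℝ, (∀ n x, 0 ≤ ν n x) ∧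
      (∀ n : ℕ, (n + 1 : ℝ) ≤ natMeas (ν n) Set.univ) ∧
      ∀ A ∈ (I : Set (Set ℕ)), Tendsto (fun n => natMeas (ν n) A) atTop (𝓝 0) := by
    intro I
    obtain ⟨ν, h0, hmass, hν⟩ := exists_measures_of_mem_ANclass (hsub I.2)
    obtain ⟨k, hk, hk'⟩ := extraction_forall_of_eventually
      (P := fun n m => (n : ℝ) + 1 ≤ natMeas (ν m) Set.univ)
      (fun n : ℕ => hmass.eventually_ge_atTop ((n : ℝ) + 1))
    exact ⟨fun n => ν (k n), fun n => h0 (k n), hk',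
      fun A hA => (hν A hA).comp hk.tendsto_atTop⟩
  choose ν h0 hmass hν using hex
  obtain ⟨g, hg⟩ := exists_eventually_le_of_card_lt hcard fun I n => (ν I n).support.card
  refine ⟨_, annihilated_mem_ANclass (ν := fun n => blockMeas n (g n + 1))
    (fun n => blockMeas_nonneg n _) ?_ fun x => ?_, fun I hI => ?_⟩
  · refine tendsto_natCast_atTop_atTop.congr fun n => ?_
    rw [natMeas_blockMeas]
    simp
    field_simp
  · refine tendsto_const_nhds.congr' ?_
    filter_upwards [eventually_gt_atTop x] with n hn
    rw [blockMeas, Finsupp.indicator_of_notMem]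
    intro hx
    obtain ⟨j, -, rfl⟩ := Finset.mem_image.1 hx
    exact absurd (Nat.left_le_pair n j) (not_le.2 hn)
  · have hloc : ∀ n, ∃ φ : ℕ → ℕ, (ν ⟨I, hI⟩ n).support.card ≤ g n →
        ∀ f : ℕ → ℕ, (∀ j, f (Nat.pair n j) = φ j) → ∀ A : Set ℕ,
          natMeas (blockMeas n (g n + 1)) (f ⁻¹' A) ≤ natMeas (ν ⟨I, hI⟩ n) A := by
      intro n
      by_cases hn : (ν ⟨I, hI⟩ n).support.card ≤ g n
      · obtain ⟨φ, hφ⟩ := exists_blockMeas_preimage_le (h0 ⟨I, hI⟩ n) (Nat.succ_pos (g n))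
          (hmass ⟨I, hI⟩ n) (hn.trans (Nat.le_succ _))
        exact ⟨φ, fun _ => hφ⟩
      · exact ⟨id, fun h => absurd h hn⟩
    choose φ hφ using hloc
    refine ⟨fun x => φ x.unpair.1 x.unpair.2, fun A hA => ?_⟩
    refine squeeze_zero' (Eventually.of_forall fun n =>
      natMeas_nonneg (blockMeas_nonneg n _) _) ?_ (hν ⟨I, hI⟩ A hA)
    filter_upwards [hg ⟨I, hI⟩] with n hn
    exact hφ n hn _ (fun j => by simp) A
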